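/- The axiom system 𝒜_R = {(Ax_{=1})} satisfies: (a) every r ∈ R is a model of 𝒜_R, hence K_{𝒜_R} = R and 𝒜_R is consistent; (b) every day in D is 𝒜_R-p-surprising, i.e., D_surpr^{𝒜_R} = D; and (c) 𝒜_R does not prove ⟨T ∈ D⟩. -/

import Mathlib

open scoped Classical

/-- Propositional formulas over the six variables `Y_r`, `r ∈ R = Fin 6`
(`0 = Mo, 1 = Tu, 2 = We, 3 = Th, 4 = Fr, 5 = none`). -/
inductive Form : Type where
  | bot : Form
  | var : Fin 6 → Form
  | imp : Form → Form → Form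
deriving DecidableEq

def Form.neg (φ : Form) : Form := φ.imp .bot
def Form.top : Form := Form.neg .bot
def Form.or (φ ψ : Form) : Form := φ.neg.imp ψ
def Form.and (φ ψ : Form) : Form := (φ.imp ψ.neg).neg

/-- Evaluation in the model `r ∈ R`: variable `Y_i` is true iff `i = r`. -/
def Form.eval (r : Fin 6) : Form → Bool
  | .bot => false
  | .var i => decide (i = r)
  | .imp φ ψ => !(Form.eval r φ) || Form.eval r ψ

/-- `r ⊨ φ`. -/
def Sat (r : Fin 6) (φ : Form) : Prop := Form.eval r φ = true

def bigOr (l : List Form) : Form := l.foldr Form.or .bot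
def bigAnd (l : List Form) : Form := l.foldr Form.and Form.top

/-- `χ_B = ⋁_{r ∈ B} Y_r`. -/
def chi (B : Finset (Fin 6)) : Form := bigOr ((B.sort (· ≤ ·)).map Form.var)

/-- The axiom `(Ax_{=1})`: exactly one of the variables `Y_r` is true. -/
def Ax1 : Form :=
  (chi Finset.univ).and
    (bigAnd ((List.finRange 6).flatMap (fun i =>
      (List.finRange 6).map (fun j =>
        if i = j then Form.top else ((Form.var i).neg).or ((Form.var j).neg)))))

/-- Provability from the axiom system `A` (by soundness and completeness of
propositional logic, semantic consequence over the six models). -/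
def Proves (A : Set Form) (φ : Form) : Prop :=
  ∀ r : Fin 6, (∀ ψ ∈ A, Sat r ψ) → Sat r φ

/-- `K` is an `A`-p-knowledge set: `A ⊢ ⟨T ∈ K⟩`. -/
def KSet (A : Set Form) (K : Finset (Fin 6)) : Prop := Proves A (chi K)

/-- `K_A`, the intersection of all `A`-p-knowledge sets. -/
noncomputable def KA (A : Set Form) : Finset (Fin 6) :=
  Finset.univ.filter (fun r => ∀ K : Finset (Fin 6), KSet A K → r ∈ K)

/-- The days `D = {Mo,…,Fr}`. -/
def DaysF : Finset (Fin 6) := {0, 1, 2, 3, 4}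

/-- `⟨T ≤ d⟩`. -/
def TLe (d : Fin 6) : Form := chi (Finset.univ.filter (· ≤ d))
/-- `⟨T ≥ d⟩`. -/
def TGe (d : Fin 6) : Form := chi (Finset.univ.filter (d ≤ ·))
/-- `⟨T = d⟩`. -/
def TEq (d : Fin 6) : Form := Form.var d

/-- Equivalence of axiom systems: mutual provability. -/
def EquivAx (A₁ A₂ : Set Form) : Prop :=
  (∀ φ ∈ A₂, Proves A₁ φ) ∧ (∀ φ ∈ A₁, Proves A₂ φ)

/-- Iverson bracket: `⊤` if `P` holds, else `⊥`. -/
noncomputable def iver (P : Prop) : Form := if P then Form.top else Form.bot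

/-- The maximum of `K` (with default `Mo` for `K = ∅`). -/
def maxD (K : Finset (Fin 6)) : Fin 6 := (K.max).getD 0

/-- `K ∖ {max K}` (with `∅ ∖ {max ∅} = ∅`). -/
def erasemax (K : Finset (Fin 6)) : Finset (Fin 6) := K.erase (maxD K)

/-- `σ^A := ⋀_{K ⊆ R} ([K_A ⊆ K] → χ_{K∖{max K}})`. -/
noncomputable def sigmaA (A : Set Form) : Form :=
  bigAnd (((Finset.univ : Finset (Finset (Fin 6))).toList).map
    (fun K => (iver (KA A ⊆ K)).imp (chi (erasemax K))))

/-- The set of `A`-p-surprising days. -/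
def Dsurpr (A : Set Form) : Set (Fin 6) :=
  {d | d ∈ DaysF ∧ d ∈ KA A ∧ ¬ Proves A (TLe d)}

/-- `A` is inconsistent iff it proves every formula. -/
def Inconsistent (A : Set Form) : Prop := ∀ φ, Proves A φ

/-- `τ^A := ⋁_{d ∈ D} ⋀_{K ⊆ R} ([A ⊢ χ_K] → [d ∈ K∖{max K}])`. -/
noncomputable def tauA (A : Set Form) : Form :=
  bigOr ((DaysF.sort (· ≤ ·)).map (fun d =>
    bigAnd (((Finset.univ : Finset (Finset (Fin 6))).toList).map
      (fun K => (iver (Proves A (chi K))).imp (iver (d ∈ erasemax K))))))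

/-- The axiom system `𝒜_L = {(Ax_{=1}), χ_L}`. -/
def AL (L : Finset (Fin 6)) : Set Form := {Ax1, chi L}

theorem sat_or {r : Fin 6} {φ ψ : Form} : Sat r (φ.or ψ) ↔ Sat r φ ∨ Sat r ψ := by
  simp [Sat, Form.or, Form.neg, Form.eval]

theorem sat_and {r : Fin 6} {φ ψ : Form} : Sat r (φ.and ψ) ↔ Sat r φ ∧ Sat r ψ := by
  simp [Sat, Form.and, Form.neg, Form.eval]

theorem sat_neg {r : Fin 6} {φ : Form} : Sat r φ.neg ↔ ¬ Sat r φ := by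
  simp [Sat, Form.neg, Form.eval]

theorem not_sat_bot {r : Fin 6} : ¬ Sat r .bot := by
  simp [Sat, Form.eval]

theorem sat_top {r : Fin 6} : Sat r Form.top :=
  sat_neg.2 not_sat_bot

theorem sat_var {r i : Fin 6} : Sat r (.var i) ↔ i = r := by
  simp [Sat, Form.eval]

theorem sat_bigOr {r : Fin 6} {l : List Form} : Sat r (bigOr l) ↔ ∃ φ ∈ l, Sat r φ := by
  induction l with
  | nil => simpa [bigOr] using not_sat_bot
  | cons φ l ih =>
    rw [List.exists_mem_cons_iff, ← ih]
    exact sat_or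

theorem sat_bigAnd {r : Fin 6} {l : List Form} : Sat r (bigAnd l) ↔ ∀ φ ∈ l, Sat r φ := by
  induction l with
  | nil => simpa [bigAnd] using sat_top
  | cons φ l ih =>
    rw [List.forall_mem_cons, ← ih]
    exact sat_and

theorem sat_chi {r : Fin 6} {B : Finset (Fin 6)} : Sat r (chi B) ↔ r ∈ B := by
  simp [chi, sat_bigOr, sat_var]

theorem sat_Ax1 (r : Fin 6) : Sat r Ax1 := by
  refine sat_and.2 ⟨sat_chi.2 (Finset.mem_univ r), sat_bigAnd.2 fun φ hφ => ?_⟩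
  obtain ⟨i, -, hi⟩ := List.mem_flatMap.1 hφ
  obtain ⟨j, -, rfl⟩ := List.mem_map.1 hi
  split_ifs with hij
  · exact sat_top
  · rw [sat_or, sat_neg, sat_neg, sat_var, sat_var]
    by_contra! h
    exact hij (h.1.trans h.2.symm)

theorem proves_Ax1_iff {φ : Form} : Proves {Ax1} φ ↔ ∀ r, Sat r φ := by
  simp [Proves, sat_Ax1]

theorem proves_Ax1_chi_iff {B : Finset (Fin 6)} :
    Proves {Ax1} (chi B) ↔ B = Finset.univ := by
  simp [proves_Ax1_iff, sat_chi, Finset.eq_univ_iff_forall]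

theorem KA_Ax1 : KA {Ax1} = Finset.univ := by
  simp [KA, KSet, proves_Ax1_chi_iff]

theorem none_notMem_DaysF : (5 : Fin 6) ∉ DaysF := by
  simp [DaysF]

theorem not_proves_Ax1_TLe {d : Fin 6} (hd : d ∈ DaysF) : ¬ Proves {Ax1} (TLe d) := by
  intro h
  have hle : (5 : Fin 6) ≤ d := by
    simpa [sat_chi, TLe] using proves_Ax1_iff.1 h 5
  have hd5 : d = 5 := le_antisymm (Fin.le_last d) hle
  exact none_notMem_DaysF (hd5 ▸ hd)

/-- Properties of `𝒜_R = {(Ax_{=1})}`: every run is a model of it, `K_{𝒜_R} = R`,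
it is consistent, every day is `𝒜_R`-p-surprising, and it does not prove
`⟨T ∈ D⟩`. -/
theorem stmt_9 :
    (∀ r : Fin 6, ∀ ψ ∈ ({Ax1} : Set Form), Sat r ψ) ∧
    KA {Ax1} = Finset.univ ∧
    ¬ Inconsistent {Ax1} ∧
    Dsurpr {Ax1} = ↑DaysF ∧
    ¬ Proves {Ax1} (chi DaysF) := by
  refine ⟨?_, KA_Ax1, fun h => not_sat_bot (proves_Ax1_iff.1 (h .bot) 0), ?_, fun h => ?_⟩
  · rintro r _ rfl
    exact sat_Ax1 r
  · ext d
    simpa [Dsurpr, KA_Ax1] using not_proves_Ax1_TLe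
  · exact none_notMem_DaysF (sat_chi.1 (proves_Ax1_iff.1 h 5))
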